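/- Let B be a reduced commutative ℂ-algebra of finite type and let M be an invertible (rank-one finitely generated projective) B-module. Then there is a natural bijection between the set of isomorphism classes of first-order deformations of the pair (B, M) — i.e. pairs (Õ, M̃) with Õ a flat ℂ[ε]/(ε²)-algebra equipped with an isomorphism Õ ⊗_{ℂ[ε]/(ε²)} ℂ ≅ B and M̃ an invertible Õ-module equipped with an isomorphism M̃ ⊗_Õ B ≅ M, up to isomorphisms compatible with these data — and the group Ext¹_B(P¹_{B/ℂ}(M), M). The bijection sends (Õ, M̃) to the class of the extension 0 → M → P¹_{Õ/ℂ}(M̃) ⊗_Õ B → P¹_{B/ℂ}(M) → 0. -/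

import Mathlib

open TensorProduct

noncomputable section

section JetInfrastructure

variable (A R : Type*) [CommRing A] [CommRing R] [Algebra A R]

/-- The ring of one-jets `(R ⊗[A] R) ⧸ I²`, an `R`-algebra via the left tensor factor,
where `I` is the kernel of the multiplication map `R ⊗[A] R → R`. -/
abbrev JetAlgebra := (R ⊗[A] R) ⧸ (KaehlerDifferential.ideal A R ^ 2)

/-- `(R ⊗[A] R) ⧸ I²` regarded as an `R`-module via the *right* tensor factor. -/
def JetRight : Type _ := JetAlgebra A R

instance : AddCommGroup (JetRight A R) := inferInstanceAs (AddCommGroup (JetAlgebra A R))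

/-- The right inclusion `R → (R ⊗[A] R)/I²`, `r ↦ [1 ⊗ r]`. -/
def jetRightHom : R →+* JetAlgebra A R :=
  (Ideal.Quotient.mk (KaehlerDifferential.ideal A R ^ 2)).comp
    (Algebra.TensorProduct.includeRight (R := A) (A := R) (B := R)).toRingHom

/-- The right-factor `R`-module structure. -/
instance : Module R (JetRight A R) :=
  Module.compHom (JetAlgebra A R) (jetRightHom A R)

instance : Module (JetAlgebra A R) (JetRight A R) :=
  inferInstanceAs (Module (JetAlgebra A R) (JetAlgebra A R))

instance : SMulCommClass R (JetAlgebra A R) (JetRight A R) := by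
  constructor
  intro r q x
  show jetRightHom A R r * (q * (show JetAlgebra A R from x)) =
    q * (jetRightHom A R r * (show JetAlgebra A R from x))
  ring

variable (N : Type*) [AddCommGroup N] [Module R N]

/-- The module of one-jets `P¹_{R/A}(N) = ((R ⊗[A] R)/I²) ⊗[R] N`, the tensor product
being taken with respect to the right-factor `R`-module structure of `(R ⊗[A] R)/I²`. -/
def JetModule : Type _ := JetRight A R ⊗[R] N

instance : AddCommGroup (JetModule A R N) :=
  inferInstanceAs (AddCommGroup (JetRight A R ⊗[R] N))

instance : Module (JetAlgebra A R) (JetModule A R N) :=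
  inferInstanceAs (Module (JetAlgebra A R) (JetRight A R ⊗[R] N))

/-- The *left* `R`-module structure on `P¹_{R/A}(N)`, via the left tensor factor. -/
instance : Module R (JetModule A R N) :=
  Module.compHom (JetRight A R ⊗[R] N) (algebraMap R (JetAlgebra A R))

variable {A R N}

/-- The class of `x ⊗ n` in `P¹_{R/A}(N)`. -/
def JetModule.mk (x : R ⊗[A] R) (n : N) : JetModule A R N :=
  (show JetRight A R from
    Ideal.Quotient.mk (KaehlerDifferential.ideal A R ^ 2) x) ⊗ₜ[R] n

/-- The one-jet map `p₁ : N → P¹_{R/A}(N)`, `n ↦ [1 ⊗ 1] ⊗ n`. -/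
def jetOne (A : Type*) [CommRing A] {R N : Type*} [CommRing R] [Algebra A R]
    [AddCommGroup N] [Module R N] (n : N) : JetModule A R N :=
  JetModule.mk (1 : R ⊗[A] R) n

end JetInfrastructure

/-- An invertible module: a rank-one finitely generated projective module. -/
def IsInvertibleModule (R M : Type*) [CommRing R] [AddCommGroup M] [Module R M] : Prop :=
  Module.Finite R M ∧ Module.Projective R M ∧
    ∀ (p : Ideal R) (hp : p.IsPrime),
      Module.finrank (Localization (p.primeCompl (hp := hp)))
        (LocalizedModule (p.primeCompl (hp := hp)) M) = 1

open scoped DualNumber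

universe u

/-- A first-order deformation of the pair `(B, M)`: a flat `ℂ[ε]/(ε²)`-algebra `O`
with `O ⊗_{ℂ[ε]} ℂ ≅ B` (encoded by the surjection `π` with kernel `ε·O`), and an
invertible `O`-module `Mt` with `Mt ⊗_O B ≅ M` (encoded by the surjection `σ` with
kernel `ε·Mt`). -/
structure FirstOrderDeformation (B M : Type u) [CommRing B] [Algebra ℂ B]
    [AddCommGroup M] [Module B M] : Type (u + 1) where
  O : Type u
  [ringO : CommRing O]
  [algε : Algebra ℂ[ε] O]
  [algℂ : Algebra ℂ O]
  [tower : IsScalarTower ℂ ℂ[ε] O]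
  flat : Module.Flat ℂ[ε] O
  Mt : Type u
  [addMt : AddCommGroup Mt]
  [modMt : Module O Mt]
  inv : IsInvertibleModule O Mt
  π : O →ₐ[ℂ] B
  πsurj : Function.Surjective π
  πker : ∀ o : O, π o = 0 ↔ ∃ o' : O, o = algebraMap ℂ[ε] O ε * o'
  σ : Mt →+ M
  σsurj : Function.Surjective σ
  σker : ∀ m : Mt, σ m = 0 ↔ ∃ m' : Mt, m = algebraMap ℂ[ε] O ε • m'
  σsmul : ∀ (o : O) (m : Mt), σ (o • m) = π o • σ m

attribute [instance] FirstOrderDeformation.ringO FirstOrderDeformation.algε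
  FirstOrderDeformation.algℂ FirstOrderDeformation.tower
  FirstOrderDeformation.addMt FirstOrderDeformation.modMt

/-- Isomorphism of first-order deformations of `(B, M)`: a `ℂ[ε]/(ε²)`-algebra
isomorphism together with a compatible module isomorphism, commuting with the
identifications with `B` and `M`. -/
def FirstOrderDeformation.Iso {B M : Type u} [CommRing B] [Algebra ℂ B]
    [AddCommGroup M] [Module B M]
    (D₁ D₂ : FirstOrderDeformation B M) : Prop :=
  ∃ (φ : D₁.O ≃ₐ[ℂ[ε]] D₂.O) (ψ : D₁.Mt ≃+ D₂.Mt),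
    (∀ o : D₁.O, D₂.π (φ o) = D₁.π o) ∧
    (∀ (o : D₁.O) (m : D₁.Mt), ψ (o • m) = φ o • ψ m) ∧
    (∀ m : D₁.Mt, D₂.σ (ψ m) = D₁.σ m)

/-- An extension `0 → G → E → F → 0` of `B`-modules. -/
structure ModuleExtension (B : Type u) (F G : Type u) [CommRing B]
    [AddCommGroup F] [Module B F] [AddCommGroup G] [Module B G] : Type (u + 1) where
  E : Type u
  [addE : AddCommGroup E]
  [modE : Module B E]
  ι : G →ₗ[B] E
  p : E →ₗ[B] F
  ιinj : Function.Injective ι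
  psurj : Function.Surjective p
  exact : Function.Exact ι p

attribute [instance] ModuleExtension.addE ModuleExtension.modE

/-- Equivalence of module extensions: a `B`-linear isomorphism of the middle terms
commuting with the structure maps. -/
def ModuleExtension.Iso {B F G : Type u} [CommRing B]
    [AddCommGroup F] [Module B F] [AddCommGroup G] [Module B G]
    (e₁ e₂ : ModuleExtension B F G) : Prop :=
  ∃ φ : e₁.E ≃ₗ[B] e₂.E,
    (∀ y : G, φ (e₁.ι y) = e₂.ι y) ∧ (∀ x : e₁.E, e₂.p (φ x) = e₁.p x)

/-- `ext` represents the extension `0 → M → P¹_{Õ/ℂ}(M̃) ⊗_Õ B → P¹_{B/ℂ}(M) → 0`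
attached to the first-order deformation `D` of `(B, M)`. -/
def IsJetExtension {B M : Type u} [CommRing B] [Algebra ℂ B]
    [AddCommGroup M] [Module B M] (D : FirstOrderDeformation B M)
    (ext : ModuleExtension B (JetModule ℂ B M) M) : Prop :=
  letI : Algebra D.O B := D.π.toRingHom.toAlgebra
  ∃ e : ext.E ≃ₗ[B] (B ⊗[D.O] JetModule ℂ D.O D.Mt),
    -- the inclusion of `M` is `σ(m̃) ↦ [1 ⊗ ε·1 - ε·1 ⊗ 1] ⊗ m̃`
    (∀ m : D.Mt, e (ext.ι (D.σ m)) =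
      (1 : B) ⊗ₜ[D.O] JetModule.mk
        ((1 : D.O) ⊗ₜ[ℂ] (algebraMap ℂ[ε] D.O ε) -
          (algebraMap ℂ[ε] D.O ε) ⊗ₜ[ℂ] (1 : D.O)) m) ∧
    -- the projection is the natural restriction map `r`
    (∀ (b : B) (x y : D.O) (m : D.Mt),
      ext.p (e.symm (b ⊗ₜ[D.O] JetModule.mk (x ⊗ₜ[ℂ] y) m)) =
        b • JetModule.mk ((D.π x : B) ⊗ₜ[ℂ] (D.π y : B)) (D.σ m))

/-! ### Invertible modules -/

section Invertible

open Module

variable {R N : Type*} [CommRing R] [AddCommGroup N] [Module R N]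

variable (R N) in
theorem exists_dual_basis [Module.Finite R N] [Module.Projective R N] :
    ∃ (n : ℕ) (c : Fin n → Module.Dual R N) (v : Fin n → N), ∀ x, ∑ i, c i x • v i = x := by
  obtain ⟨n, f, g, -, -, hfg⟩ := Module.Finite.exists_comp_eq_id_of_projective R N
  refine ⟨n, fun i => LinearMap.proj i ∘ₗ g, fun i => f (Pi.single i 1), fun x => ?_⟩
  conv_rhs => rw [← LinearMap.id_apply (R := R) x, ← hfg, LinearMap.comp_apply,
    LinearMap.pi_apply_eq_sum_univ f (g x)]
  refine Finset.sum_congr rfl fun i _ => congrArg _ (congrArg f (funext fun j => ?_))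
  simp [Pi.single_apply, eq_comm]

/-- A linear form for which `f x • y` is symmetric in `x` and `y`. -/
def IsRankOneForm (f : Module.Dual R N) : Prop :=
  ∀ x y : N, f x • y = f y • x

theorem forall_isRankOneForm_of_one_mem_span
    (h : (1 : R) ∈ Ideal.span {r | ∃ f : Module.Dual R N, IsRankOneForm f ∧ ∃ m, f m = r})
    (g : Module.Dual R N) : IsRankOneForm g := by
  intro x y
  have key : ∀ r ∈ Ideal.span {r | ∃ f : Module.Dual R N, IsRankOneForm f ∧ ∃ m, f m = r},
      r • (g x • y) = r • (g y • x) := by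
    intro r hr
    induction hr using Submodule.span_induction with
    | mem r hr =>
      obtain ⟨f, hf, m, rfl⟩ := hr
      have h1 : g x * f y = g y * f x := by
        have := congrArg g (hf x y)
        simp only [map_smul, smul_eq_mul] at this
        linear_combination -this
      rw [smul_comm, hf m y, smul_comm (f m), hf m x, smul_smul, smul_smul, h1]
    | zero => simp
    | add a b _ _ ha hb => rw [add_smul, add_smul, ha, hb]
    | smul c a _ ha => rw [smul_assoc, smul_assoc, ha]
  simpa using key 1 h

theorem module_invertible_of_one_mem_span
    (h : (1 : R) ∈ Ideal.span {r | ∃ f : Module.Dual R N, IsRankOneForm f ∧ ∃ m, f m = r}) :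
    Module.Invertible R N := by
  have hall := forall_isRankOneForm_of_one_mem_span h
  have hr : (1 : R) ∈ LinearMap.range (contractLeft R N) := by
    refine (Ideal.span_le (I := LinearMap.range (contractLeft R N))).2 ?_ h
    rintro _ ⟨f, -, m, rfl⟩
    exact ⟨f ⊗ₜ m, by simp⟩
  have comm : ∀ t z : Module.Dual R N ⊗[R] N,
      contractLeft R N t • z = contractLeft R N z • t := by
    intro t z
    induction t with
    | zero => simp
    | add a b ha hb => rw [map_add, add_smul, ha, hb, smul_add]
    | tmul f m =>
      induction z with
      | zero => simp
      | add a b ha hb => rw [map_add, add_smul, ← ha, ← hb, smul_add]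
      | tmul g n =>
        have h1 : f n • g = g n • f := by
          ext y
          have := congrArg g (hall f n y)
          simp only [map_smul, smul_eq_mul] at this
          simp only [LinearMap.smul_apply, smul_eq_mul, this]
          ring
        rw [contractLeft_apply, contractLeft_apply, ← TensorProduct.tmul_smul, hall f m n,
          TensorProduct.tmul_smul, TensorProduct.smul_tmul', h1, ← TensorProduct.smul_tmul']
  obtain ⟨t, ht⟩ := hr
  refine ⟨?_, fun r => ⟨r • t, by simp [ht]⟩⟩
  rw [injective_iff_map_eq_zero]
  intro z hz
  have := comm t z
  rwa [ht, hz, one_smul, zero_smul] at this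

theorem IsInvertibleModule.of_module_invertible [Module.Invertible R N] :
    IsInvertibleModule R N :=
  ⟨inferInstance, inferInstance, fun _ _ => Module.Invertible.finrank_eq_one _ _⟩

theorem IsInvertibleModule.module_invertible (h : IsInvertibleModule R N) :
    Module.Invertible R N := by
  obtain ⟨_, _, hrk⟩ := h
  have loc : ∀ (p : Ideal R) [p.IsPrime], Nonempty (LocalizedModule p.primeCompl N
      ≃ₗ[Localization p.primeCompl] Localization p.primeCompl) := by
    intro p hp
    have : IsLocalRing (Localization p.primeCompl) :=
      inferInstanceAs (IsLocalRing (Localization.AtPrime p))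
    have : Module.Free (Localization p.primeCompl) (LocalizedModule p.primeCompl N) :=
      Module.free_of_flat_of_isLocalRing
    exact ⟨LinearEquiv.ofFinrankEq _ _ ((hrk p hp).trans (Module.finrank_self _).symm)⟩
  have hall : ∀ f : Module.Dual R N, IsRankOneForm f := by
    intro f x y
    refine Module.eq_of_localization_maximal
      (fun (P : Ideal R) _ => LocalizedModule P.primeCompl N)
      (fun P _ => LocalizedModule.mkLinearMap P.primeCompl N) _ _ fun P _ => ?_
    obtain ⟨e⟩ := loc P
    let L := Localization P.primeCompl
    let ι := LocalizedModule.mkLinearMap P.primeCompl N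
    let F : LocalizedModule P.primeCompl N →ₗ[L] L :=
      IsLocalizedModule.mapExtendScalars P.primeCompl ι (Algebra.linearMap R L) L f
    have hF : ∀ z, F (ι z) = algebraMap R L (f z) := fun z =>
      IsLocalizedModule.map_apply P.primeCompl ι (Algebra.linearMap R L) f z
    have hsym : ∀ a b : LocalizedModule P.primeCompl N, F a • b = F b • a := by
      intro a b
      have hc : ∀ c, F c = e c * F (e.symm 1) := fun c => by
        rw [← smul_eq_mul, ← map_smul, ← map_smul, smul_eq_mul, mul_one, e.symm_apply_apply]
      apply e.injective
      rw [map_smul, map_smul, hc a, hc b, smul_eq_mul, smul_eq_mul]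
      ring
    have := hsym (ι x) (ι y)
    rw [hF, hF, algebraMap_smul, algebraMap_smul] at this
    rw [map_smul, map_smul]
    exact this
  apply module_invertible_of_one_mem_span
  obtain ⟨n, c, v, hexp⟩ := exists_dual_basis R N
  have htr : ∀ x : N, (∑ i, c i (v i)) • x = x := fun x => by
    rw [Finset.sum_smul]
    conv_rhs => rw [← hexp x]
    exact Finset.sum_congr rfl fun i _ => hall (c i) _ _
  have h1 : ∑ i, c i (v i) = 1 := by
    refine Module.eq_of_localization_maximal
      (fun (P : Ideal R) _ => Localization P.primeCompl)
      (fun P _ => Algebra.linearMap R (Localization P.primeCompl)) _ _ fun P _ => ?_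
    obtain ⟨e⟩ := loc P
    have : ∀ y : LocalizedModule P.primeCompl N, (∑ i, c i (v i)) • y = y := by
      intro y
      induction y with
      | h x s => rw [LocalizedModule.smul'_mk, htr]
    have := congrArg e (this (e.symm 1))
    rw [← algebraMap_smul (Localization P.primeCompl), map_smul, e.apply_symm_apply,
      smul_eq_mul, mul_one] at this
    rw [Algebra.linearMap_apply, Algebra.linearMap_apply, this, map_one]
  rw [← h1]
  exact Ideal.sum_mem _ fun i _ => Ideal.subset_span ⟨c i, hall _, v i, rfl⟩

end Invertible

/-! ### First-order operators and jets -/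

section FirstOrder

variable {R S N T : Type*} [CommRing R] [CommRing S] [AddCommGroup N] [Module R N]
  [AddCommGroup T] [Module S T]

/-- `δ : N → T` is a differential operator of order at most one over the ring map `π`. -/
def IsFirstOrder (π : R →+* S) (δ : N →+ T) : Prop :=
  ∀ (r s : R) (n : N),
    δ ((r * s) • n) + (π r * π s) • δ n = π r • δ (s • n) + π s • δ (r • n)

theorem IsFirstOrder.comp {T' : Type*} [AddCommGroup T'] [Module S T'] {π : R →+* S}
    {δ : N →+ T} (h : IsFirstOrder π δ) (f : T →ₗ[S] T') :
    IsFirstOrder π (f.toAddMonoidHom.comp δ) := fun r s n => by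
  have := congrArg f (h r s n)
  rw [map_add, map_add, f.map_smul, f.map_smul, f.map_smul] at this
  exact this

/-- The commutator of a first-order operator with multiplication by `r`. -/
def IsFirstOrder.commutator {π : R →+* S} {δ : N →+ T} (h : IsFirstOrder π δ) (r : R) :
    N →ₛₗ[π] T where
  toFun n := δ (r • n) - π r • δ n
  map_add' m n := by simp only [smul_add, map_add]; abel
  map_smul' s n := by
    have := h r s n
    rw [smul_sub, smul_smul, smul_smul, mul_comm (π s), ← sub_eq_zero] at *
    rw [← this]
    abel

@[simp]
theorem IsFirstOrder.commutator_apply {π : R →+* S} {δ : N →+ T} (h : IsFirstOrder π δ) (r : R)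
    (n : N) : h.commutator r n = δ (r • n) - π r • δ n := rfl

end FirstOrder

section JetUniversal

variable {A R N : Type*} [CommRing A] [CommRing R] [Algebra A R] [AddCommGroup N] [Module R N]

namespace JetModule

theorem mk_add_left (x y : R ⊗[A] R) (n : N) :
    (mk (x + y) n : JetModule A R N) = mk x n + mk y n := by
  let q : R ⊗[A] R → JetRight A R := Ideal.Quotient.mk (KaehlerDifferential.ideal A R ^ 2)
  exact TensorProduct.add_tmul (R := R) (q x) (q y) n

theorem mk_sub_left (x y : R ⊗[A] R) (n : N) :
    (mk (x - y) n : JetModule A R N) = mk x n - mk y n :=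
  eq_sub_of_add_eq (by rw [← mk_add_left, sub_add_cancel])

theorem mk_one_tmul_mul (x : R ⊗[A] R) (r : R) (n : N) :
    (mk (((1 : R) ⊗ₜ r) * x) n : JetModule A R N) = mk x (r • n) :=
  TensorProduct.smul_tmul (R := R) (R' := R) r
    (show JetRight A R from Ideal.Quotient.mk (KaehlerDifferential.ideal A R ^ 2) x) n

theorem smul_mk (r : R) (x : R ⊗[A] R) (n : N) :
    r • (mk x n : JetModule A R N) = mk ((r ⊗ₜ (1 : R)) * x) n := rfl

theorem mk_tmul (x y : R) (n : N) :
    (mk (x ⊗ₜ y) n : JetModule A R N) = x • jetOne A (y • n) := by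
  rw [jetOne, smul_mk, ← mk_one_tmul_mul, mul_one, Algebra.TensorProduct.tmul_mul_tmul, one_mul,
    mul_one]

theorem mk_eq_zero {x : R ⊗[A] R} (hx : x ∈ KaehlerDifferential.ideal A R ^ 2) (n : N) :
    (mk x n : JetModule A R N) = 0 := by
  unfold mk
  rw [Ideal.Quotient.eq_zero_iff_mem.2 hx]
  exact TensorProduct.zero_tmul (R := R) (JetRight A R) n

theorem induction_on {P : JetModule A R N → Prop} (z : JetModule A R N) (zero : P 0)
    (smul_jetOne : ∀ (r : R) (n : N), P (r • jetOne A n))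
    (add : ∀ x y, P x → P y → P (x + y)) : P z := by
  refine TensorProduct.induction_on (motive := P) z zero (fun q n => ?_) add
  obtain ⟨x, rfl⟩ := Ideal.Quotient.mk_surjective (show JetAlgebra A R from q)
  change P (mk x n)
  induction x with
  | zero => rw [mk_eq_zero (zero_mem _)]; exact zero
  | add x y hx hy => rw [mk_add_left]; exact add _ _ hx hy
  | tmul x y => rw [mk_tmul]; exact smul_jetOne _ _

end JetModule

variable (A R N) in
/-- The universal first-order operator, as an additive map. -/
def jetHom : N →+ JetModule A R N where
  toFun := jetOne A
  map_zero' := TensorProduct.tmul_zero (R := R) (M := JetRight A R) _ _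
  map_add' _ _ := TensorProduct.tmul_add (R := R) (M := JetRight A R) _ _ _

@[simp]
theorem jetHom_apply (n : N) : jetHom A R N n = jetOne A n := rfl

theorem jetOne_algebraMap_smul (a : A) (n : N) :
    (jetOne A (algebraMap A R a • n) : JetModule A R N) = algebraMap A R a • jetOne A n := by
  have h := JetModule.mk_tmul (A := A) (1 : R) (algebraMap A R a) n
  rw [one_smul] at h
  rw [← h, jetOne, JetModule.smul_mk, mul_one]
  congr 1
  rw [Algebra.algebraMap_eq_smul_one, TensorProduct.tmul_smul, TensorProduct.smul_tmul']

theorem isFirstOrder_jetHom : IsFirstOrder (RingHom.id R) (jetHom A R N) := by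
  intro r s n
  have hmem : ∀ r : R, (1 : R) ⊗ₜ[A] r - r ⊗ₜ[A] (1 : R) ∈ KaehlerDifferential.ideal A R :=
    KaehlerDifferential.one_smul_sub_smul_one_mem_ideal A
  have h := JetModule.mk_eq_zero
    (by rw [pow_two]; exact Ideal.mul_mem_mul (hmem r) (hmem s)) n
  have e : ((1 : R) ⊗ₜ[A] r - r ⊗ₜ[A] (1 : R)) * ((1 : R) ⊗ₜ[A] s - s ⊗ₜ[A] (1 : R)) =
      ((1 : R) ⊗ₜ[A] (r * s) + (r * s) ⊗ₜ[A] (1 : R)) -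
        (r ⊗ₜ[A] s + s ⊗ₜ[A] r) := by
    simp only [sub_mul, mul_sub, Algebra.TensorProduct.tmul_mul_tmul, one_mul, mul_one]
    abel
  rw [e, JetModule.mk_sub_left, JetModule.mk_add_left, JetModule.mk_add_left, sub_eq_zero] at h
  simp only [JetModule.mk_tmul, one_smul] at h
  simpa using h

variable {S T : Type*} [CommRing S] [AddCommGroup T] [Module S T]

theorem jet_semilinear_ext {π : R →+* S} {f g : JetModule A R N →ₛₗ[π] T}
    (h : ∀ n, f (jetOne A n) = g (jetOne A n)) : f = g := by
  ext z
  induction z using JetModule.induction_on with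
  | zero => simp
  | smul_jetOne r n => simp [h]
  | add x y hx hy => simp [hx, hy]

/-- The additive map `x ⊗ y ↦ (n ↦ π x • δ (y • n))` underlying the universal property of the
module of one-jets. -/
def tensorAct (π : R →+* S) (δ : N →+ T)
    (hA : ∀ (a : A) (n : N), δ (algebraMap A R a • n) = π (algebraMap A R a) • δ n) :
    R ⊗[A] R →+ N →+ T :=
  TensorProduct.liftAddHom (R := A)
    (AddMonoidHom.mk' (fun x => AddMonoidHom.mk'
      (fun y => AddMonoidHom.mk' (fun n => π x • δ (y • n))
        (fun m n => by simp only [smul_add, map_add]))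
      (fun y z => by ext n; simp [add_smul]))
      (fun x y => by ext z n; simp [add_smul]))
    (fun a x y => by
      ext n
      simp only [AddMonoidHom.mk'_apply, Algebra.smul_def, map_mul, mul_smul, hA]
      rw [smul_comm])

theorem tensorAct_tmul (π : R →+* S) (δ : N →+ T)
    (hA : ∀ (a : A) (n : N), δ (algebraMap A R a • n) = π (algebraMap A R a) • δ n)
    (x y : R) (n : N) : tensorAct π δ hA (x ⊗ₜ y) n = π x • δ (y • n) := rfl

theorem tensorAct_mul_tmul (π : R →+* S) (δ : N →+ T)
    (hA : ∀ (a : A) (n : N), δ (algebraMap A R a • n) = π (algebraMap A R a) • δ n)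
    (w : R ⊗[A] R) (x y : R) (n : N) :
    tensorAct π δ hA ((x ⊗ₜ y) * w) n = π x • tensorAct π δ hA w (y • n) := by
  induction w with
  | zero => simp
  | add a b ha hb => simp only [mul_add, map_add, AddMonoidHom.add_apply, ha, hb, smul_add]
  | tmul a b =>
    rw [Algebra.TensorProduct.tmul_mul_tmul, tensorAct_tmul, tensorAct_tmul, map_mul, mul_smul,
      mul_comm y, mul_smul]

theorem tensorAct_eq_zero {π : R →+* S} {δ : N →+ T}
    (hA : ∀ (a : A) (n : N), δ (algebraMap A R a • n) = π (algebraMap A R a) • δ n)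
    (hδ : IsFirstOrder π δ) {z : R ⊗[A] R} (hz : z ∈ KaehlerDifferential.ideal A R ^ 2) :
    tensorAct π δ hA z = 0 := by
  rw [pow_two, ← KaehlerDifferential.span_range_eq_ideal, Ideal.span_mul_span'] at hz
  have key : ∀ w : R ⊗[A] R, tensorAct π δ hA (w * z) = 0 := by
    induction hz using Submodule.span_induction with
    | mem z hz =>
      obtain ⟨_, ⟨r, rfl⟩, _, ⟨s, rfl⟩, rfl⟩ := Set.mem_mul.1 hz
      intro w
      induction w with
      | zero => simp
      | add a b ha hb => rw [add_mul, map_add, ha, hb, add_zero]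
      | tmul x y =>
        ext n
        have := hδ r s (y • n)
        rw [tensorAct_mul_tmul]
        simp only [sub_mul, mul_sub, Algebra.TensorProduct.tmul_mul_tmul, one_mul, mul_one,
          map_sub, AddMonoidHom.sub_apply, tensorAct_tmul, map_one, one_smul, map_mul,
          AddMonoidHom.zero_apply]
        rw [← sub_eq_zero] at this
        rw [← smul_zero (π x), ← this]
        congr 1
        abel
    | zero => simp
    | add a b _ _ ha hb => intro w; rw [mul_add, map_add, ha, hb, add_zero]
    | smul c a _ ha => intro w; rw [smul_eq_mul, ← mul_assoc]; exact ha _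
  simpa using key 1

/-- The universal property of the module of one-jets: first-order operators factor through it. -/
theorem exists_jet_lift {π : R →+* S} {δ : N →+ T}
    (hA : ∀ (a : A) (n : N), δ (algebraMap A R a • n) = π (algebraMap A R a) • δ n)
    (hδ : IsFirstOrder π δ) :
    ∃ f : JetModule A R N →ₛₗ[π] T, ∀ n, f (jetOne A n) = δ n := by
  let q : JetAlgebra A R →+ N →+ T :=
    QuotientAddGroup.lift _ (tensorAct π δ hA) fun z hz => tensorAct_eq_zero hA hδ hz
  have hq : ∀ z n, q (Ideal.Quotient.mk _ z) n = tensorAct π δ hA z n := fun _ _ => rfl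
  let f : JetModule A R N →+ T := TensorProduct.liftAddHom (R := R) (M := JetRight A R) (N := N) q
    (fun r m n => by
      obtain ⟨x, rfl⟩ := Ideal.Quotient.mk_surjective (show JetAlgebra A R from m)
      change q (Ideal.Quotient.mk _ (((1 : R) ⊗ₜ r) * x)) n = q (Ideal.Quotient.mk _ x) (r • n)
      rw [hq, hq, tensorAct_mul_tmul, map_one, one_smul])
  have hf : ∀ z n, f (JetModule.mk z n) = tensorAct π δ hA z n := fun _ _ => rfl
  have hone : ∀ n, f (jetOne A n) = δ n := fun n => by
    rw [jetOne, hf, Algebra.TensorProduct.one_def, tensorAct_tmul, map_one, one_smul, one_smul]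
  have hsm : ∀ (r : R) n, f (r • jetOne A n) = π r • δ n := fun r n => by
    rw [← one_smul R n, ← JetModule.mk_tmul, hf, tensorAct_tmul, one_smul]
  refine ⟨⟨f, fun r z => ?_⟩, hone⟩
  change f (r • z) = π r • f z
  induction z using JetModule.induction_on with
  | zero => simp
  | smul_jetOne s n => rw [smul_smul, hsm, hsm, map_mul, mul_smul]
  | add x y hx hy => rw [smul_add, map_add, hx, hy, map_add, smul_add]

/-- Extension of scalars of a semilinear map. -/
theorem exists_baseChange_lift [Algebra R S] {J : Type*} [AddCommGroup J] [Module R J]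
    (g : J →ₛₗ[algebraMap R S] T) :
    ∃ h : S ⊗[R] J →ₗ[S] T, ∀ b x, h (b ⊗ₜ x) = b • g x := by
  let _ : Module R T := Module.compHom T (algebraMap R S)
  have : IsScalarTower R S T := ⟨fun r s t => by
    rw [Algebra.smul_def, mul_smul]; rfl⟩
  let g' : J →ₗ[R] T := ⟨g.toAddHom, fun r x => g.map_smulₛₗ r x⟩
  exact ⟨g'.liftBaseChange S, fun b x => LinearMap.liftBaseChange_tmul _ _ _ _⟩

end JetUniversal

/-! ### The deformation attached to an extension -/

section Model

variable {B M : Type u} [CommRing B] [Algebra ℂ B] [AddCommGroup M] [Module B M]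

theorem jetOne_mul_smul (b c : B) (m : M) :
    (jetOne ℂ ((b * c) • m) : JetModule ℂ B M) =
      b • jetOne ℂ (c • m) + c • jetOne ℂ (b • m) - (b * c) • jetOne ℂ m :=
  eq_sub_of_add_eq (isFirstOrder_jetHom (A := ℂ) b c m)

@[simp]
theorem jetOne_add (m n : M) :
    (jetOne ℂ (m + n) : JetModule ℂ B M) = jetOne ℂ m + jetOne ℂ n :=
  map_add (jetHom ℂ B M) m n

@[simp]
theorem jetOne_neg (m : M) : (jetOne ℂ (-m) : JetModule ℂ B M) = -jetOne ℂ m :=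
  map_neg (jetHom ℂ B M) m

@[simp]
theorem jetOne_zero : (jetOne ℂ (0 : M) : JetModule ℂ B M) = 0 :=
  map_zero (jetHom ℂ B M)

variable (X : ModuleExtension B (JetModule ℂ B M) M)

/-- The pairs `(b, θ)` where `θ : M → E` is a lift of the commutator of the universal first-order
operator with `b`. -/
def ModuleExtension.ring : AddSubgroup (B × (M →ₗ[B] X.E)) where
  carrier := {x | ∀ m, X.p (x.2 m) = jetOne ℂ (x.1 • m) - x.1 • jetOne ℂ m}
  zero_mem' m := by simp
  add_mem' {x y} hx hy m := by
    simp only [Prod.fst_add, Prod.snd_add, LinearMap.add_apply, map_add, hx m, hy m, add_smul,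
      jetOne_add]
    abel
  neg_mem' {x} hx m := by
    simp only [Prod.fst_neg, Prod.snd_neg, LinearMap.neg_apply, map_neg, hx m, neg_smul,
      jetOne_neg]
    abel

/-- The pairs `(m, e)` where `e` lifts the one-jet of `m`. -/
def ModuleExtension.mod : AddSubgroup (M × X.E) where
  carrier := {x | X.p x.2 = jetOne ℂ x.1}
  zero_mem' := by simp
  add_mem' {x y} hx hy := by
    simp only [Set.mem_ofPred_eq] at hx hy
    simp [hx, hy]
  neg_mem' {x} hx := by
    simp only [Set.mem_ofPred_eq] at hx
    simp [hx]

namespace ModuleExtension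

variable {X}

theorem p_ι (m : M) : X.p (X.ι m) = 0 := X.exact.apply_apply_eq_zero m

theorem ring_p (x : X.ring) (m : M) :
    X.p (x.1.2 m) = jetOne ℂ (x.1.1 • m) - x.1.1 • jetOne ℂ m := x.2 m

theorem mod_p (x : X.mod) : X.p x.1.2 = jetOne ℂ x.1.1 := x.2

instance : One X.ring := ⟨⟨(1, 0), fun m => by simp⟩⟩

instance : Mul X.ring :=
  ⟨fun x y => ⟨(x.1.1 * y.1.1, x.1.1 • y.1.2 + y.1.1 • x.1.2), fun m => by
    simp only [LinearMap.add_apply, LinearMap.smul_apply, map_add, map_smul, ring_p,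
      jetOne_mul_smul, smul_sub, smul_smul, mul_comm y.1.1 x.1.1]
    abel⟩⟩

@[simp] theorem ring_one_fst : (1 : X.ring).1.1 = 1 := rfl
@[simp] theorem ring_one_snd : (1 : X.ring).1.2 = 0 := rfl
@[simp] theorem ring_mul_fst (x y : X.ring) : (x * y).1.1 = x.1.1 * y.1.1 := rfl
@[simp] theorem ring_mul_snd (x y : X.ring) :
    (x * y).1.2 = x.1.1 • y.1.2 + y.1.1 • x.1.2 := rfl

theorem ring_ext {x y : X.ring} (h₁ : x.1.1 = y.1.1) (h₂ : x.1.2 = y.1.2) : x = y :=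
  Subtype.ext (Prod.ext h₁ h₂)

theorem mod_ext {x y : X.mod} (h₁ : x.1.1 = y.1.1) (h₂ : x.1.2 = y.1.2) : x = y :=
  Subtype.ext (Prod.ext h₁ h₂)

instance : CommRing X.ring where
  __ := AddSubgroup.toAddCommGroup X.ring
  mul_assoc x y z := ring_ext (by simp [mul_assoc]) (by
    simp only [ring_mul_snd, ring_mul_fst]; module)
  one_mul x := ring_ext (by simp) (by simp)
  mul_one x := ring_ext (by simp) (by simp)
  zero_mul x := ring_ext (by simp) (by simp)
  mul_zero x := ring_ext (by simp) (by simp)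
  left_distrib x y z := ring_ext (by simp [mul_add]) (by simp; module)
  right_distrib x y z := ring_ext (by simp [add_mul]) (by simp; module)
  mul_comm x y := ring_ext (by simp [mul_comm]) (by simp; module)

instance : SMul X.ring X.mod :=
  ⟨fun x y => ⟨(x.1.1 • y.1.1, x.1.1 • y.1.2 + x.1.2 y.1.1), by
    change X.p _ = _
    simp only [map_add, map_smul, ring_p, mod_p]
    abel⟩⟩

@[simp] theorem mod_smul_fst (x : X.ring) (y : X.mod) : (x • y).1.1 = x.1.1 • y.1.1 := rfl
@[simp] theorem mod_smul_snd (x : X.ring) (y : X.mod) :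
    (x • y).1.2 = x.1.1 • y.1.2 + x.1.2 y.1.1 := rfl

instance : Module X.ring X.mod where
  one_smul y := mod_ext (by simp) (by simp)
  mul_smul x y z := mod_ext (by simp [mul_smul]) (by simp; module)
  smul_zero x := mod_ext (by simp) (by simp)
  smul_add x y z := mod_ext (by simp) (by simp; module)
  add_smul x y z := mod_ext (by simp [add_smul]) (by simp; module)
  zero_smul x := mod_ext (by simp) (by simp)

variable (X) in
/-- The structure map of `X.ring` over the dual numbers. -/
def ofDualNumber : ℂ[ε] →+* X.ring where
  toFun z := ⟨(algebraMap ℂ B z.fst, algebraMap ℂ B z.snd • X.ι), fun m => by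
    simp [jetOne_algebraMap_smul, p_ι]⟩
  map_one' := ring_ext (by simp) (by simp)
  map_zero' := ring_ext (by simp) (by simp)
  map_add' x y := ring_ext (by simp) (by simp [add_smul])
  map_mul' x y := ring_ext (by simp) (by simp [add_smul, mul_smul]; module)

instance : Algebra ℂ[ε] X.ring := (ofDualNumber X).toAlgebra

instance : Algebra ℂ X.ring := ((ofDualNumber X).comp (algebraMap ℂ ℂ[ε])).toAlgebra

instance : IsScalarTower ℂ ℂ[ε] X.ring := ⟨fun a z x => by
  change ofDualNumber X (a • z) * x = ofDualNumber X (algebraMap ℂ ℂ[ε] a) * (ofDualNumber X z * x)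
  rw [← mul_assoc, ← map_mul, Algebra.smul_def]⟩

theorem algebraMap_fst (z : ℂ[ε]) : (algebraMap ℂ[ε] X.ring z).1.1 = algebraMap ℂ B z.fst := rfl

theorem algebraMap_snd (z : ℂ[ε]) :
    (algebraMap ℂ[ε] X.ring z).1.2 = algebraMap ℂ B z.snd • X.ι := rfl

@[simp] theorem algebraMap_eps_fst : (algebraMap ℂ[ε] X.ring ε).1.1 = 0 := by
  simp [algebraMap_fst]

@[simp] theorem algebraMap_eps_snd : (algebraMap ℂ[ε] X.ring ε).1.2 = X.ι := by
  simp [algebraMap_snd]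

variable (X) in
/-- The projection of `X.ring` to `B`. -/
def ringProj : X.ring →ₐ[ℂ] B where
  toFun x := x.1.1
  map_one' := rfl
  map_zero' := rfl
  map_add' _ _ := rfl
  map_mul' _ _ := rfl
  commutes' r := by
    change algebraMap ℂ B (algebraMap ℂ ℂ[ε] r).fst = _
    simp [TrivSqZeroExt.algebraMap_eq_inl]

@[simp] theorem ringProj_apply (x : X.ring) : ringProj X x = x.1.1 := rfl

variable (X) in
/-- The projection of `X.mod` to `M`. -/
def modProj : X.mod →+ M where
  toFun x := x.1.1
  map_zero' := rfl
  map_add' _ _ := rfl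

@[simp] theorem modProj_apply (x : X.mod) : modProj X x = x.1.1 := rfl

theorem modProj_surjective : Function.Surjective (modProj X) := fun m => by
  obtain ⟨e, he⟩ := X.psurj (jetOne ℂ m)
  exact ⟨⟨(m, e), he⟩, rfl⟩

theorem modProj_eq_zero_iff (x : X.mod) :
    modProj X x = 0 ↔ ∃ y : X.mod, x = algebraMap ℂ[ε] X.ring ε • y := by
  refine ⟨fun h => ?_, ?_⟩
  · rw [modProj_apply] at h
    have hx : X.p x.1.2 = 0 := by rw [mod_p, h, jetOne_zero]
    obtain ⟨m, hm⟩ := (X.exact _).1 hx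
    obtain ⟨y, rfl⟩ := modProj_surjective (X := X) m
    exact ⟨y, mod_ext (by simp [h]) (by simpa using hm.symm)⟩
  · rintro ⟨y, rfl⟩
    simp

theorem ringProj_surjective [Module.Projective B M] : Function.Surjective (ringProj X) := by
  intro b
  obtain ⟨θ, hθ⟩ := Module.projective_lifting_property X.p
    ((isFirstOrder_jetHom (A := ℂ) (R := B) (N := M)).commutator b) X.psurj
  exact ⟨⟨(b, θ), fun m => LinearMap.congr_fun hθ m⟩, rfl⟩

theorem ringProj_eq_zero_iff [Module.Invertible B M] (x : X.ring) :
    ringProj X x = 0 ↔ ∃ y : X.ring, x = algebraMap ℂ[ε] X.ring ε * y := by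
  refine ⟨fun h => ?_, ?_⟩
  · rw [ringProj_apply] at h
    have hx : ∀ m, X.p (x.1.2 m) = 0 := fun m => by rw [ring_p, h, zero_smul, zero_smul]; simp
    have hr : ∀ m, x.1.2 m ∈ LinearMap.range X.ι := fun m => (X.exact _).1 (hx m)
    let t : M →ₗ[B] M :=
      (LinearEquiv.ofInjective X.ι X.ιinj).symm.toLinearMap ∘ₗ x.1.2.codRestrict _ hr
    have ht : ∀ m, X.ι (t m) = x.1.2 m := fun m =>
      congrArg Subtype.val ((LinearEquiv.ofInjective X.ι X.ιinj).apply_symm_apply _)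
    obtain ⟨b, hb⟩ := (Module.Invertible.toModuleEnd_bijective B M).2 t
    obtain ⟨y, rfl⟩ := ringProj_surjective (X := X) b
    refine ⟨y, ring_ext (by simp [h]) (LinearMap.ext fun m => ?_)⟩
    rw [← ht, ← hb]
    simp
  · rintro ⟨y, rfl⟩
    simp

theorem ring_eq_zero_of_eps_mul_eq_zero [Module.Invertible B M] {x : X.ring}
    (h : algebraMap ℂ[ε] X.ring ε * x = 0) : ringProj X x = 0 := by
  have h2 := congrArg (fun z : X.ring => z.1.2) h
  apply FaithfulSMul.eq_of_smul_eq_smul (α := M)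
  intro m
  apply X.ιinj
  simpa using LinearMap.congr_fun h2 m

end ModuleExtension

theorem flat_dualNumber_of_forall {k P : Type*} [Field k] [AddCommGroup P] [Module k[ε] P]
    (h : ∀ x : P, (ε : k[ε]) • x = 0 → ∃ y : P, x = (ε : k[ε]) • y) : Module.Flat k[ε] P := by
  rw [Module.Flat.iff_lift_lsmul_comp_subtype_injective]
  intro I _
  by_cases hu : ∃ z ∈ I, z.fst ≠ 0
  · obtain ⟨z, hz, hz0⟩ := hu
    have htop : I = ⊤ := by
      refine Ideal.eq_top_of_isUnit_mem I hz ?_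
      rwa [TrivSqZeroExt.isUnit_iff_isUnit_fst, isUnit_iff_ne_zero]
    subst htop
    have : Function.Injective
        ((TensorProduct.lid k[ε] P).toLinearMap ∘ₗ
          (LinearEquiv.rTensor P (Submodule.topEquiv (R := k[ε]) (M := k[ε]))).toLinearMap) :=
      (TensorProduct.lid k[ε] P).injective.comp (LinearEquiv.injective _)
    convert this using 2
    ext
    simp
  push Not at hu
  rw [injective_iff_map_eq_zero]
  by_cases hε : (ε : k[ε]) ∈ I
  · have gen : ∀ t : I ⊗[k[ε]] P, ∃ x : P, t = (⟨ε, hε⟩ : I) ⊗ₜ x := by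
      intro t
      induction t with
      | zero => exact ⟨0, by simp⟩
      | add a b ha hb =>
        obtain ⟨x, rfl⟩ := ha
        obtain ⟨y, rfl⟩ := hb
        exact ⟨x + y, by rw [TensorProduct.tmul_add]⟩
      | tmul i x =>
        refine ⟨(TrivSqZeroExt.inl i.1.snd : k[ε]) • x, ?_⟩
        rw [← TensorProduct.smul_tmul]
        congr 1
        ext
        · simp [hu i.1 i.2]
        · simp
    intro t ht
    obtain ⟨x, rfl⟩ := gen t
    obtain ⟨y, rfl⟩ := h x (by simpa using ht)
    have h0 : (ε : k[ε]) • (⟨ε, hε⟩ : I) = 0 := Subtype.ext (by simp)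
    rw [← TensorProduct.smul_tmul, h0, TensorProduct.zero_tmul]
  · have : Subsingleton I := by
      refine ⟨fun i j => ?_⟩
      have hz : ∀ i : I, i = 0 := by
        intro i
        have hs : i.1.snd = 0 := by
          by_contra hs
          apply hε
          have := I.mul_mem_left (TrivSqZeroExt.inl i.1.snd⁻¹) i.2
          convert this
          ext
          · simp [hu i.1 i.2]
          · simp [hs]
        ext
        · simp [hu i.1 i.2]
        · simp [hs]
      rw [hz i, hz j]
    intro t _
    exact Subsingleton.elim _ _

end Model

theorem isRankOneForm_of_invertible {R N : Type*} [CommRing R] [AddCommGroup N] [Module R N]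
    [Module.Invertible R N] (f : Module.Dual R N) :
    IsRankOneForm f := fun x y => by
  simpa using congrArg ((TensorProduct.lid R N).toLinearMap ∘ₗ f.rTensor N)
    (Module.Invertible.tmul_comm (m₁ := x) (m₂ := y))

section ModelInvertible

variable {B M : Type u} [CommRing B] [Algebra ℂ B] [AddCommGroup M] [Module B M]

namespace ModuleExtension

variable (X : ModuleExtension B (JetModule ℂ B M) M)

theorem exists_symmetric_lift [Module.Projective B M] {f : Module.Dual B M}
    (hf : IsRankOneForm f) :
    ∃ G : M →ₗ[B] M →ₗ[B] X.E,
      (∀ m n, X.p (G m n) = jetOne ℂ (f n • m) - f m • jetOne ℂ n - f n • jetOne ℂ m) ∧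
        ∀ m n, G m n = G n m := by
  let g (m n : M) : JetModule ℂ B M := jetOne ℂ (f n • m) - f m • jetOne ℂ n - f n • jetOne ℂ m
  have hsymm : ∀ m n, g m n = g n m := fun m n => by
    simp only [g]
    rw [hf n m]
    abel
  have hg : ∀ n, ∃ t : M →ₗ[B] JetModule ℂ B M, ∀ m, g m n = t m := fun n =>
    ⟨(isFirstOrder_jetHom (A := ℂ)).commutator (f n) - f.smulRight (jetOne ℂ n), fun m => by
      simp only [g, LinearMap.sub_apply, IsFirstOrder.commutator_apply, LinearMap.smulRight_apply,
        jetHom_apply, RingHom.id_apply]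
      abel⟩
  choose t ht using hg
  let g₂ : M →ₗ[B] M →ₗ[B] JetModule ℂ B M := LinearMap.mk₂ B g
    (fun m m' n => by rw [ht, ht, ht, map_add]) (fun c m n => by rw [ht, ht, map_smul])
    (fun m n n' => by rw [hsymm, hsymm m n, hsymm m n', ht, ht, ht, map_add])
    (fun c m n => by rw [hsymm, hsymm m n, ht, ht, map_smul])
  obtain ⟨L, hL⟩ := Module.projective_lifting_property X.p (TensorProduct.lift g₂) X.psurj
  have hL' : ∀ m n, X.p (L (m ⊗ₜ n)) = g m n := fun m n => by
    rw [← LinearMap.comp_apply, hL, TensorProduct.lift.tmul]; rfl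
  let c : B := algebraMap ℂ B (1 / 2)
  have hc : c + c = 1 := by
    simp only [c]
    rw [← map_add]
    norm_num
  refine ⟨c • (TensorProduct.mk B M M).compr₂ L + c • ((TensorProduct.mk B M M).compr₂ L).flip,
    fun m n => ?_, fun m n => ?_⟩
  · simp only [LinearMap.add_apply, LinearMap.smul_apply, LinearMap.compr₂_apply, mk_apply,
      LinearMap.flip_apply, map_add, map_smul, hL', hsymm n m]
    rw [← add_smul, hc, one_smul]
  · simp only [LinearMap.add_apply, LinearMap.smul_apply, LinearMap.compr₂_apply, mk_apply,
      LinearMap.flip_apply]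
    abel

theorem exists_rankOneForm_lift [Module.Projective B M] {f : Module.Dual B M}
    (hf : IsRankOneForm f) :
    ∃ F : Module.Dual X.ring X.mod, IsRankOneForm F ∧
      ∀ x, ringProj X (F x) = f (modProj X x) := by
  obtain ⟨G, hG, hsymm⟩ := X.exists_symmetric_lift hf
  refine ⟨{ toFun x := ⟨(f x.1.1, f.smulRight x.1.2 + G x.1.1), fun n => ?_⟩
            map_add' x y := ring_ext (by simp) (by ext; simp; abel)
            map_smul' x y := ring_ext (by simp) (by
              ext n
              have := congrArg x.1.2 (hf n y.1.1)
              simp only [map_smul] at this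
              simp [this]
              module) }, fun x y => ?_, fun x => rfl⟩
  · simp only [LinearMap.add_apply, LinearMap.smulRight_apply, map_add, map_smul, mod_p, hG]
    rw [hf n]
    abel
  · refine mod_ext (by simpa using hf _ _) ?_
    simp [hsymm x.1.1]
    abel

theorem mod_invertible [Module.Invertible B M] : Module.Invertible X.ring X.mod := by
  apply module_invertible_of_one_mem_span
  set I := Ideal.span
    {r | ∃ f : Module.Dual X.ring X.mod, IsRankOneForm f ∧ ∃ m, f m = r} with hI
  have hmap : (1 : B) ∈ I.map (ringProj X) := by
    obtain ⟨t, ht⟩ := (Module.Invertible.bijective (R := B) (M := M)).2 1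
    rw [← ht]
    clear ht
    induction t with
    | zero => simp
    | add a b ha hb => rw [map_add]; exact add_mem ha hb
    | tmul f m =>
      obtain ⟨F, hF, hFf⟩ := X.exists_rankOneForm_lift (isRankOneForm_of_invertible f)
      obtain ⟨x, rfl⟩ := modProj_surjective (X := X) m
      rw [contractLeft_apply, ← hFf]
      exact Ideal.mem_map_of_mem _ (Ideal.subset_span ⟨F, hF, x, rfl⟩)
  obtain ⟨r, hr, hr1⟩ := (Ideal.mem_map_iff_of_surjective _ ringProj_surjective).1 hmap
  obtain ⟨y, hy⟩ := (ringProj_eq_zero_iff (r - 1)).1 (by rw [map_sub, hr1, map_one, sub_self])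
  have hε : algebraMap ℂ[ε] X.ring ε * algebraMap ℂ[ε] X.ring ε = 0 := by
    rw [← map_mul, DualNumber.eps_mul_eps, map_zero]
  have : (1 : X.ring) = (2 - r) * r := by
    obtain rfl : r = 1 + algebraMap ℂ[ε] X.ring ε * y := by rw [← hy]; ring
    linear_combination y ^ 2 * hε
  rw [this]
  exact I.mul_mem_left _ hr

/-- The first-order deformation attached to an extension of `P¹(M)` by `M`. -/
def toDeformation [Module.Invertible B M] : FirstOrderDeformation B M where
  O := X.ring
  Mt := X.mod
  flat := flat_dualNumber_of_forall fun x hx => by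
    rw [Algebra.smul_def] at hx
    obtain ⟨y, hy⟩ := (ringProj_eq_zero_iff x).1 (ring_eq_zero_of_eps_mul_eq_zero hx)
    exact ⟨y, by rw [hy, Algebra.smul_def]⟩
  inv := have := X.mod_invertible; .of_module_invertible
  π := ringProj X
  πsurj := ringProj_surjective
  πker := ringProj_eq_zero_iff
  σ := modProj X
  σsurj := modProj_surjective
  σker := modProj_eq_zero_iff
  σsmul _ _ := rfl

end ModuleExtension

end ModelInvertible

/-! ### Isomorphisms of deformations and of extensions -/

section Iso

variable {B : Type u} [CommRing B]

namespace ModuleExtension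

variable {F G : Type u} [AddCommGroup F] [Module B F] [AddCommGroup G] [Module B G]

theorem Iso.equivalence : Equivalence (Iso (B := B) (F := F) (G := G)) where
  refl _ := ⟨.refl _ _, fun _ => rfl, fun _ => rfl⟩
  symm := fun ⟨φ, h₁, h₂⟩ => ⟨φ.symm, fun y => by rw [← h₁, φ.symm_apply_apply],
    fun x => by rw [← h₂, φ.apply_symm_apply]⟩
  trans := fun ⟨φ, h₁, h₂⟩ ⟨χ, k₁, k₂⟩ => ⟨φ.trans χ, fun y => by simp [h₁, k₁],
    fun x => by simp [h₂, k₂]⟩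

theorem iso_of_hom {X X' : ModuleExtension B F G} (f : X.E →ₗ[B] X'.E)
    (hι : ∀ y, f (X.ι y) = X'.ι y) (hp : ∀ x, X'.p (f x) = X.p x) : X.Iso X' := by
  refine ⟨LinearEquiv.ofBijective f ⟨?_, fun y => ?_⟩, hι, hp⟩
  · rw [injective_iff_map_eq_zero]
    intro x hx
    obtain ⟨y, rfl⟩ := (X.exact x).1 (by rw [← hp, hx, map_zero])
    rw [hι, map_eq_zero_iff _ X'.ιinj] at hx
    rw [hx, map_zero]
  · obtain ⟨x, hx⟩ := X.psurj (X'.p y)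
    obtain ⟨z, hz⟩ := (X'.exact (y - f x)).1 (by rw [map_sub, hp, hx, sub_self])
    exact ⟨x + X.ι z, by rw [map_add, hι, hz]; abel⟩

end ModuleExtension

namespace FirstOrderDeformation

variable [Algebra ℂ B] {M : Type u} [AddCommGroup M] [Module B M]

theorem Iso.symm {D D' : FirstOrderDeformation B M} : D.Iso D' → D'.Iso D :=
  fun ⟨φ, ψ, h₁, h₂, h₃⟩ => ⟨φ.symm, ψ.symm, fun o => by rw [← h₁, φ.apply_symm_apply],
    fun o m => ψ.injective (by simp [h₂]), fun m => by rw [← h₃, ψ.apply_symm_apply]⟩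

theorem Iso.trans {D D' D'' : FirstOrderDeformation B M} :
    D.Iso D' → D'.Iso D'' → D.Iso D'' :=
  fun ⟨φ, ψ, h₁, h₂, h₃⟩ ⟨φ', ψ', k₁, k₂, k₃⟩ =>
    ⟨φ.trans φ', ψ.trans ψ', fun o => by simp [h₁, k₁], fun o m => by simp [h₂, k₂],
      fun m => by simp [h₃, k₃]⟩

end FirstOrderDeformation

end Iso

/-! ### First-order operators linking a deformation and an extension -/

section Link

variable {B M : Type u} [CommRing B] [Algebra ℂ B] [AddCommGroup M] [Module B M]

namespace FirstOrderDeformation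

variable (D : FirstOrderDeformation B M)

/-- The image of `ε` in a deformation. -/
abbrev eps : D.O := algebraMap ℂ[ε] D.O ε

theorem eps_mul_eps : D.eps * D.eps = 0 := by
  rw [← map_mul, DualNumber.eps_mul_eps, map_zero]

@[simp]
theorem π_eps : D.π D.eps = 0 := (D.πker _).2 ⟨1, (mul_one _).symm⟩

/-- An additive map out of `Mt` killing `ε Mt` descends along `σ`. -/
theorem exists_add_descent {T : Type*} [AddCommGroup T] (g : D.Mt →+ T)
    (hg : ∀ m, g (D.eps • m) = 0) : ∃ h : M →+ T, ∀ m, h (D.σ m) = g m := by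
  have key : ∀ m m', D.σ m = D.σ m' → g m = g m' := by
    intro m m' h
    obtain ⟨n, hn⟩ := (D.σker (m - m')).1 (by rw [map_sub, h, sub_self])
    rw [← sub_eq_zero, ← map_sub, hn, hg]
  refine ⟨AddMonoidHom.mk' (fun n => g (Function.surjInv D.σsurj n)) fun a b => ?_, fun m => ?_⟩
  · rw [← map_add]
    exact key _ _ (by simp [Function.surjInv_eq])
  · exact key _ _ (Function.surjInv_eq _ _)

/-- A semilinear map out of `Mt` descends along `σ`. -/
theorem exists_descent {T : Type*} [AddCommGroup T] [Module B T]
    (g : D.Mt →ₛₗ[D.π.toRingHom] T) : ∃ h : M →ₗ[B] T, ∀ m, h (D.σ m) = g m := by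
  obtain ⟨h, hh⟩ := D.exists_add_descent g.toAddMonoidHom fun m => by
    change g _ = 0
    rw [map_smulₛₗ]
    change D.π D.eps • g m = 0
    rw [D.π_eps, zero_smul]
  refine ⟨⟨h, fun b n => ?_⟩, hh⟩
  obtain ⟨o, rfl⟩ := D.πsurj b
  obtain ⟨m, rfl⟩ := D.σsurj n
  change h _ = D.π.toRingHom o • h _
  rw [← D.σsmul, hh, hh]
  exact map_smulₛₗ g o m

end FirstOrderDeformation

/-- `δ` is a first-order operator from a deformation to an extension which lifts the universal
first-order operator on `M` and restricts to `ι` on `ε Mt ≅ M`. -/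
structure IsLink (D : FirstOrderDeformation B M) (X : ModuleExtension B (JetModule ℂ B M) M)
    (δ : D.Mt →+ X.E) : Prop where
  firstOrder : IsFirstOrder D.π.toRingHom δ
  algebraMap_smul (a : ℂ) (m : D.Mt) : δ (algebraMap ℂ D.O a • m) = algebraMap ℂ B a • δ m
  p_apply (m : D.Mt) : X.p (δ m) = jetOne ℂ (D.σ m)
  eps_smul (m : D.Mt) : δ (D.eps • m) = X.ι (D.σ m)

theorem IsLink.comp_iso {D : FirstOrderDeformation B M}
    {X X' : ModuleExtension B (JetModule ℂ B M) M} {δ : D.Mt →+ X.E} (h : IsLink D X δ)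
    (hX : X.Iso X') : ∃ δ', IsLink D X' δ' := by
  obtain ⟨χ, h₁, h₂⟩ := hX
  exact ⟨χ.toLinearMap.toAddMonoidHom.comp δ, h.firstOrder.comp χ.toLinearMap,
    fun a m => by simp [h.algebraMap_smul], fun m => by simp [h₂, h.p_apply],
    fun m => by simp [h₁, h.eps_smul]⟩

theorem IsLink.iso_comp {D D' : FirstOrderDeformation B M}
    {X : ModuleExtension B (JetModule ℂ B M) M} {δ : D.Mt →+ X.E} (h : IsLink D X δ)
    (hD : D'.Iso D) : ∃ δ', IsLink D' X δ' := by
  obtain ⟨φ, ψ, h₁, h₂, h₃⟩ := hD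
  refine ⟨δ.comp ψ.toAddMonoidHom, fun r s n => ?_, fun a m => ?_, fun m => ?_, fun m => ?_⟩
  · have := h.firstOrder (φ r) (φ s) (ψ n)
    simp only [← map_mul, ← h₂] at this
    change δ (ψ _) + (D'.π r * D'.π s) • δ (ψ _) = D'.π r • δ (ψ _) + D'.π s • δ (ψ _)
    rw [← h₁ r, ← h₁ s, ← map_mul, ← map_mul]
    exact this
  · have hφ : φ (algebraMap ℂ D'.O a) = algebraMap ℂ D.O a := by
      rw [IsScalarTower.algebraMap_apply ℂ ℂ[ε] D'.O, IsScalarTower.algebraMap_apply ℂ ℂ[ε] D.O,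
        φ.commutes]
    change δ (ψ _) = _ • δ (ψ _)
    rw [h₂, hφ, h.algebraMap_smul]
  · change X.p (δ (ψ _)) = _
    rw [h.p_apply, h₃]
  · change δ (ψ _) = _
    rw [h₂, φ.commutes, h.eps_smul, h₃]

/-- A morphism of modules filtered by `ε` which induces the identity on the quotient is
bijective. -/
theorem bijective_of_eps {P Q N : Type*} [AddCommGroup P] [AddCommGroup Q] [AddCommGroup N]
    (p : P →+ N) (q : Q →+ N) (eP : P →+ P) (eQ : Q →+ Q) (f : P →+ Q)
    (hf : ∀ x, q (f x) = p x) (hfe : ∀ x, f (eP x) = eQ (f x)) (hp : Function.Surjective p)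
    (kerP : ∀ x, p x = 0 → ∃ y, x = eP y) (kerQ : ∀ x, q x = 0 → ∃ y, x = eQ y)
    (eP_eP : ∀ x, eP (eP x) = 0) (eQ_eQ : ∀ x, eQ (eQ x) = 0)
    (hQ : ∀ x, eQ x = 0 → q x = 0) : Function.Bijective f := by
  constructor
  · rw [injective_iff_map_eq_zero]
    intro x hx
    obtain ⟨y, rfl⟩ := kerP x (by rw [← hf, hx, map_zero])
    obtain ⟨z, rfl⟩ := kerP y (by rw [← hf]; exact hQ _ (by rw [← hfe, hx]))
    exact eP_eP z
  · intro y
    obtain ⟨x, hx⟩ := hp (q y)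
    obtain ⟨y', hy'⟩ := kerQ (y - f x) (by rw [map_sub, hf, hx, sub_self])
    obtain ⟨x', hx'⟩ := hp (q y')
    obtain ⟨y'', hy''⟩ := kerQ (y' - f x') (by rw [map_sub, hf, hx', sub_self])
    refine ⟨x + eP x', ?_⟩
    rw [map_add, hfe, ← sub_eq_zero, ← neg_eq_zero, ← eQ_eQ y'', ← hy'', map_sub, ← hy']
    abel

theorem ModuleExtension.exists_isLink_toDeformation [Module.Invertible B M]
    (X : ModuleExtension B (JetModule ℂ B M) M) : ∃ δ, IsLink X.toDeformation X δ := by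
  refine ⟨(AddMonoidHom.snd M X.E).comp X.mod.subtype, fun (r s : X.ring) (n : X.mod) => ?_,
    fun a (m : X.mod) => ?_, fun m => mod_p m, fun (m : X.mod) => ?_⟩
  · change ((r * s) • n).1.2 + (r.1.1 * s.1.1) • n.1.2 =
      r.1.1 • (s • n).1.2 + s.1.1 • (r • n).1.2
    simp
    module
  · change (algebraMap ℂ[ε] X.ring (algebraMap ℂ ℂ[ε] a) • m).1.2 = algebraMap ℂ B a • m.1.2
    simp [algebraMap_fst, algebraMap_snd, TrivSqZeroExt.algebraMap_eq_inl]
  · change (algebraMap ℂ[ε] X.ring ε • m).1.2 = X.ι m.1.1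
    simp

theorem IsLink.iso_toDeformation [Module.Invertible B M] {D : FirstOrderDeformation B M}
    {X : ModuleExtension B (JetModule ℂ B M) M} {δ : D.Mt →+ X.E} (h : IsLink D X δ) :
    D.Iso X.toDeformation := by
  choose θ hθ using fun o : D.O => D.exists_descent (h.firstOrder.commutator o)
  replace hθ : ∀ o m, θ o (D.σ m) = δ (o • m) - D.π o • δ m := hθ
  have ext_σ : ∀ {f g : M →ₗ[B] X.E}, (∀ m, f (D.σ m) = g (D.σ m)) → f = g := fun hfg =>
    LinearMap.ext fun n => by
      obtain ⟨m, rfl⟩ := D.σsurj n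
      exact hfg m
  let φ₀ : D.O →+* X.ring :=
    { toFun o := ⟨(D.π o, θ o), fun n => by
        obtain ⟨m, rfl⟩ := D.σsurj n
        simp only [hθ, map_sub, map_smul, h.p_apply, D.σsmul]⟩
      map_one' := ModuleExtension.ring_ext (map_one _) (ext_σ fun m => by simp [hθ])
      map_zero' := ModuleExtension.ring_ext (map_zero _) (ext_σ fun m => by simp [hθ])
      map_add' a b := ModuleExtension.ring_ext (map_add _ _ _)
        (ext_σ fun m => by simp [hθ, add_smul]; abel)
      map_mul' a b := ModuleExtension.ring_ext (map_mul _ _ _) (ext_σ fun m => by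
        have := h.firstOrder a b m
        change _ + (D.π a * D.π b) • δ m = D.π a • _ + D.π b • _ at this
        simp only [hθ, ModuleExtension.ring_mul_snd, LinearMap.add_apply, LinearMap.smul_apply,
          map_mul, smul_sub, smul_smul, mul_comm (D.π b)]
        rw [eq_sub_of_add_eq this]
        abel) }
  have hφε : φ₀ D.eps = algebraMap ℂ[ε] X.ring ε :=
    ModuleExtension.ring_ext (by simp [φ₀]) (ext_σ fun m => by
      simp [φ₀, hθ, h.eps_smul])
  have hφa : ∀ a : ℂ, φ₀ (algebraMap ℂ D.O a) = algebraMap ℂ X.ring a := fun a =>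
    ModuleExtension.ring_ext (by
      change D.π (algebraMap ℂ D.O a) = ModuleExtension.ringProj X (algebraMap ℂ X.ring a)
      rw [AlgHom.commutes, AlgHom.commutes]) (ext_σ fun m => by
      change θ _ _ = (algebraMap ℂ[ε] X.ring (algebraMap ℂ ℂ[ε] a)).1.2 _
      simp [hθ, h.algebraMap_smul, ModuleExtension.algebraMap_snd,
        TrivSqZeroExt.algebraMap_eq_inl])
  have hφz : ∀ z : ℂ[ε], φ₀ (algebraMap ℂ[ε] D.O z) = algebraMap ℂ[ε] X.ring z := by
    intro z
    have hz : z = algebraMap ℂ ℂ[ε] z.fst + algebraMap ℂ ℂ[ε] z.snd * ε := by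
      ext <;> simp [TrivSqZeroExt.algebraMap_eq_inl]
    rw [hz, map_add, map_mul, map_add, map_mul, map_add, map_mul, hφε,
      ← IsScalarTower.algebraMap_apply, ← IsScalarTower.algebraMap_apply, hφa, hφa]
    rfl
  let φ : D.O →ₐ[ℂ[ε]] X.ring := { φ₀ with commutes' := hφz }
  let ψ : D.Mt →+ X.mod :=
    { toFun m := ⟨(D.σ m, δ m), h.p_apply m⟩
      map_zero' := ModuleExtension.mod_ext (map_zero _) (map_zero _)
      map_add' a b := ModuleExtension.mod_ext (map_add _ _ _) (map_add _ _ _) }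
  have hψ : ∀ (o : D.O) (m : D.Mt), ψ (o • m) = φ o • ψ m := fun o m =>
    ModuleExtension.mod_ext (D.σsmul o m) (by
      change δ (o • m) = D.π o • δ m + θ o (D.σ m)
      rw [hθ]
      abel)
  have hXε : algebraMap ℂ[ε] X.ring ε * algebraMap ℂ[ε] X.ring ε = 0 := by
    rw [← map_mul, DualNumber.eps_mul_eps, map_zero]
  have φ_bij : Function.Bijective φ := bijective_of_eps (D.π : D.O →+ B)
    (ModuleExtension.ringProj X : X.ring →+ B) (AddMonoidHom.mulLeft D.eps)
    (AddMonoidHom.mulLeft (algebraMap ℂ[ε] X.ring ε)) (φ : D.O →+ X.ring) (fun x => rfl)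
    (fun x => by simp) D.πsurj (fun x => (D.πker x).1)
    (fun x => (ModuleExtension.ringProj_eq_zero_iff x).1)
    (fun x => by simp [← mul_assoc, D.eps_mul_eps])
    (fun x => by simp [← mul_assoc, hXε])
    (fun x => ModuleExtension.ring_eq_zero_of_eps_mul_eq_zero)
  have ψ_bij : Function.Bijective ψ := bijective_of_eps D.σ (ModuleExtension.modProj X)
    (DistribSMul.toAddMonoidHom D.Mt D.eps)
    (DistribSMul.toAddMonoidHom X.mod (algebraMap ℂ[ε] X.ring ε)) ψ (fun x => rfl)
    (fun x => by simp [hψ]) D.σsurj (fun x => (D.σker x).1)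
    (fun x => (ModuleExtension.modProj_eq_zero_iff x).1)
    (fun x => by simp [smul_smul, D.eps_mul_eps])
    (fun x => by simp [smul_smul, hXε])
    (fun x hx => X.ιinj (by simpa using congrArg (fun y : X.mod => y.1.2) hx))
  exact ⟨AlgEquiv.ofBijective φ φ_bij, AddEquiv.ofBijective ψ ψ_bij, fun _ => rfl, hψ,
    fun _ => rfl⟩

end Link

/-! ### The extension attached to a deformation -/

section DeformationJet

variable {B M : Type u} [CommRing B] [Algebra ℂ B] [AddCommGroup M] [Module B M]

namespace FirstOrderDeformation

variable (D : FirstOrderDeformation B M)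

/-- `B` as an algebra over the total ring of a deformation. -/
abbrev algebraBase : Algebra D.O B := D.π.toRingHom.toAlgebra

attribute [local instance] algebraBase

/-- The restriction to `B` of the module of one-jets of the deformed module. -/
def Jet : Type u :=
  B ⊗[D.O] JetModule ℂ D.O D.Mt

instance : AddCommGroup D.Jet :=
  inferInstanceAs (AddCommGroup (B ⊗[D.O] JetModule ℂ D.O D.Mt))

instance : Module B D.Jet :=
  inferInstanceAs (Module B (B ⊗[D.O] JetModule ℂ D.O D.Mt))

/-- The canonical semilinear map from one-jets to restricted one-jets. -/
def toJet : JetModule ℂ D.O D.Mt →ₛₗ[D.π.toRingHom] D.Jet :=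
  { toFun z := (1 : B) ⊗ₜ[D.O] z
    map_add' := TensorProduct.tmul_add _
    map_smul' o z := by
      change (1 : B) ⊗ₜ[D.O] (o • z) = D.π o • ((1 : B) ⊗ₜ[D.O] z)
      rw [← TensorProduct.smul_tmul, TensorProduct.smul_tmul', Algebra.smul_def, smul_eq_mul]
      rfl }

/-- The universal first-order operator from the deformed module. -/
def jet : D.Mt →+ D.Jet := D.toJet.toAddMonoidHom.comp (jetHom ℂ D.O D.Mt)

theorem jet_apply (m : D.Mt) : D.jet m = D.toJet (jetOne ℂ m) := rfl

theorem isFirstOrder_jet : IsFirstOrder D.π.toRingHom D.jet := fun r s n => by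
  have := congrArg D.toJet (isFirstOrder_jetHom (A := ℂ) r s n)
  simp only [RingHom.id_apply, map_add, map_smulₛₗ, map_mul] at this
  exact this

theorem jet_algebraMap_smul (a : ℂ) (m : D.Mt) :
    D.jet (algebraMap ℂ D.O a • m) = algebraMap ℂ B a • D.jet m := by
  rw [jet_apply, jetOne_algebraMap_smul, map_smulₛₗ]
  change D.π _ • _ = _
  rw [D.π.commutes, jet_apply]

theorem jet_eps_smul (m : D.Mt) :
    D.jet (D.eps • m) =
      D.toJet (JetModule.mk ((1 : D.O) ⊗ₜ[ℂ] D.eps - D.eps ⊗ₜ[ℂ] (1 : D.O)) m) := by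
  rw [JetModule.mk_sub_left, JetModule.mk_tmul, JetModule.mk_tmul, map_sub, D.toJet.map_smulₛₗ D.eps]
  change _ = _ - D.π D.eps • _
  rw [D.π_eps, zero_smul, sub_zero, one_smul, jet_apply]

variable {D} {T : Type*} [AddCommGroup T] [Module B T]

theorem jet_ext {f g : D.Jet →ₗ[B] T} (h : ∀ m, f (D.jet m) = g (D.jet m)) : f = g := by
  have key : f.comp D.toJet = g.comp D.toJet := jet_semilinear_ext h
  ext z
  induction (show B ⊗[D.O] JetModule ℂ D.O D.Mt from z) using TensorProduct.induction_on with
  | zero => exact (map_zero f).trans (map_zero g).symm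
  | add a b ha hb => exact (map_add f a b).trans ((congrArg₂ _ ha hb).trans (map_add g a b).symm)
  | tmul b x =>
    have hb : (b ⊗ₜ[D.O] x : B ⊗[D.O] JetModule ℂ D.O D.Mt) = b • ((1 : B) ⊗ₜ[D.O] x) := by
      rw [TensorProduct.smul_tmul', smul_eq_mul, mul_one]
    have hx : f (D.toJet x) = g (D.toJet x) := LinearMap.congr_fun key x
    rw [hb]
    exact (map_smul f b (D.toJet x)).trans ((congrArg _ hx).trans (map_smul g b (D.toJet x)).symm)

theorem exists_lift {δ : D.Mt →+ T} (hδ : IsFirstOrder D.π.toRingHom δ)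
    (hA : ∀ (a : ℂ) m, δ (algebraMap ℂ D.O a • m) = algebraMap ℂ B a • δ m) :
    ∃ f : D.Jet →ₗ[B] T, ∀ m, f (D.jet m) = δ m := by
  obtain ⟨g, hg⟩ := exists_jet_lift (A := ℂ) (fun a n => by
    rw [hA]
    change _ = D.π _ • _
    rw [D.π.commutes]) hδ
  obtain ⟨f, hf⟩ := exists_baseChange_lift (R := D.O) (S := B) g
  exact ⟨f, fun m => (hf 1 _).trans (by rw [one_smul]; exact hg m)⟩

end FirstOrderDeformation

theorem IsJetExtension.exists_isLink {D : FirstOrderDeformation B M}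
    {X : ModuleExtension B (JetModule ℂ B M) M} (h : IsJetExtension D X) :
    ∃ δ, IsLink D X δ := by
  obtain ⟨e', h₁, h₂⟩ := h
  let e : X.E ≃ₗ[B] D.Jet := e'
  refine ⟨e.symm.toLinearMap.toAddMonoidHom.comp D.jet, D.isFirstOrder_jet.comp _,
    fun a m => ?_, fun m => ?_, fun m => ?_⟩
  · change e.symm _ = _ • e.symm _
    rw [D.jet_algebraMap_smul, map_smul]
  · refine (h₂ 1 1 1 m).trans ?_
    rw [one_smul, map_one]
    rfl
  · change e.symm _ = _
    rw [D.jet_eps_smul, LinearEquiv.symm_apply_eq]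
    exact (h₁ m).symm

theorem exists_universal_isLink (D : FirstOrderDeformation B M)
    (hD : ∀ m, D.jet (D.eps • m) = 0 → D.σ m = 0) :
    ∃ (X : ModuleExtension B (JetModule ℂ B M) M) (δ : D.Mt →+ X.E), IsLink D X δ ∧
      ∀ (X' : ModuleExtension B (JetModule ℂ B M) M) (δ' : D.Mt →+ X'.E),
        IsLink D X' δ' → X.Iso X' := by
  obtain ⟨ι, hι'⟩ := D.exists_descent (D.isFirstOrder_jet.commutator D.eps)
  have hι : ∀ m, ι (D.σ m) = D.jet (D.eps • m) := fun m => by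
    rw [hι', IsFirstOrder.commutator_apply]
    change _ - D.π D.eps • _ = _
    rw [D.π_eps, zero_smul, sub_zero]
  obtain ⟨p, hp'⟩ := FirstOrderDeformation.exists_lift (D := D)
    (δ := (jetHom ℂ B M).comp D.σ) (fun r s n => by
      have := isFirstOrder_jetHom (A := ℂ) (D.π r) (D.π s) (D.σ n)
      rw [← map_mul D.π, ← D.σsmul, ← D.σsmul, ← D.σsmul] at this
      exact this) (fun a m => by
      change jetOne ℂ _ = _ • jetOne ℂ _
      rw [D.σsmul, D.π.commutes, jetOne_algebraMap_smul])
  have hp : ∀ m, p (D.jet m) = jetOne ℂ (D.σ m) := hp'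
  have hpι : ∀ n, p (ι n) = 0 := fun n => by
    obtain ⟨m, rfl⟩ := D.σsurj n
    rw [hι, hp, D.σsmul, D.π_eps, zero_smul, jetOne_zero]
  have hker : ∀ z, p z = 0 → z ∈ LinearMap.range ι := by
    let q := (LinearMap.range ι).mkQ
    obtain ⟨s, hs'⟩ := D.exists_add_descent (q.toAddMonoidHom.comp D.jet) fun m => by
      change q _ = 0
      rw [← hι]
      exact (Submodule.Quotient.mk_eq_zero _).2 ⟨_, rfl⟩
    have hs : ∀ m, s (D.σ m) = q (D.jet m) := hs'
    obtain ⟨t, ht⟩ := exists_jet_lift (A := ℂ) (π := RingHom.id B) (δ := s)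
      (fun a n => by
        obtain ⟨m, rfl⟩ := D.σsurj n
        rw [← D.π.commutes, ← D.σsmul, hs, D.jet_algebraMap_smul, map_smul, hs, D.π.commutes]
        rfl)
      (fun a b n => by
        obtain ⟨m, rfl⟩ := D.σsurj n
        obtain ⟨a, rfl⟩ := D.πsurj a
        obtain ⟨b, rfl⟩ := D.πsurj b
        simp only [RingHom.id_apply]
        rw [← map_mul, ← D.σsmul, ← D.σsmul, ← D.σsmul, hs, hs, hs, hs, map_mul]
        exact D.isFirstOrder_jet.comp q a b m)
    have htp : t.comp p = q := FirstOrderDeformation.jet_ext fun m => by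
      rw [LinearMap.comp_apply, hp, ht, hs]
    intro z hz
    rw [← Submodule.Quotient.mk_eq_zero]
    change q z = 0
    rw [← htp, LinearMap.comp_apply, hz, map_zero]
  let X : ModuleExtension B (JetModule ℂ B M) M :=
    { E := D.Jet
      ι := ι
      p := p
      ιinj := by
        rw [injective_iff_map_eq_zero]
        intro n hn
        obtain ⟨m, rfl⟩ := D.σsurj n
        exact hD m (by rw [← hι, hn])
      psurj := fun z => by
        induction z using JetModule.induction_on with
        | zero => exact ⟨0, map_zero _⟩
        | smul_jetOne b n =>
          obtain ⟨m, rfl⟩ := D.σsurj n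
          exact ⟨b • D.jet m, by rw [map_smul, hp]⟩
        | add x y hx hy =>
          obtain ⟨x, rfl⟩ := hx
          obtain ⟨y, rfl⟩ := hy
          exact ⟨x + y, map_add _ _ _⟩
      exact := fun z => ⟨hker z, by rintro ⟨n, rfl⟩; exact hpι n⟩ }
  refine ⟨X, D.jet, ⟨D.isFirstOrder_jet, D.jet_algebraMap_smul, hp, fun m => (hι m).symm⟩,
    fun X' δ' h => ?_⟩
  obtain ⟨f, hf⟩ := FirstOrderDeformation.exists_lift h.firstOrder h.algebraMap_smul
  refine ModuleExtension.iso_of_hom (X := X) f (fun n => ?_) (fun x => ?_)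
  · obtain ⟨m, rfl⟩ := D.σsurj n
    change f (ι _) = _
    rw [hι, hf, h.eps_smul]
  · have : X'.p.comp f = p := FirstOrderDeformation.jet_ext fun m => by
      rw [LinearMap.comp_apply, hf, h.p_apply, hp]
    exact LinearMap.congr_fun this x

end DeformationJet

/-! ### Exactness over a reduced base -/

section Reduced

theorem exists_derivation_of_section {A L K : Type*} [CommRing A] [CommRing L] [CommRing K]
    [Algebra A L] [Algebra A K] (h : L →ₐ[A] K) (s : K →ₐ[A] L) (hs : ∀ x, h (s x) = x) (e : L)
    (hker : ∀ x, h x = 0 → ∃ z, x = e * z) (hann : ∀ z, e * z = 0 → h z = 0) (he : h e = 0) :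
    ∃ d : L →+ K, (∀ x y, d (x * y) = h x * d y + h y * d x) ∧
      (∀ a : A, d (algebraMap A L a) = 0) ∧ ∀ z, d (e * z) = h z := by
  have hex : ∀ x, ∃ z, x - s (h x) = e * z := fun x =>
    hker _ (by rw [map_sub, hs, sub_self])
  choose z hz using hex
  have huniq : ∀ x w, x - s (h x) = e * w → h (z x) = h w := fun x w hw => by
    rw [← sub_eq_zero, ← map_sub]
    exact hann _ (by rw [mul_sub, ← hz, hw, sub_self])
  refine ⟨AddMonoidHom.mk' (fun x => h (z x)) fun x y => ?_, fun x y => ?_, fun a => ?_,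
    fun w => ?_⟩
  · rw [← map_add]
    refine huniq _ _ ?_
    rw [mul_add, ← hz, ← hz, map_add, map_add]
    ring
  · have := huniq (x * y) (x * z y + s (h y) * z x) (by
      rw [map_mul, map_mul]
      linear_combination x * hz y + s (h y) * hz x)
    simpa only [AddMonoidHom.mk'_apply, map_add, map_mul, hs] using this
  · have := huniq (algebraMap A L a) 0 (by
      rw [h.commutes, s.commutes, sub_self, mul_zero])
    simpa using this
  · exact huniq (e * w) w (by rw [map_mul, he, zero_mul, map_zero, sub_zero])

namespace FirstOrderDeformation

variable {B M : Type u} [CommRing B] [Algebra ℂ B] [AddCommGroup M] [Module B M]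
  (D : FirstOrderDeformation B M)

theorem π_eq_zero_of_eps_mul_eq_zero {x : D.O} (h : D.eps * x = 0) : D.π x = 0 := by
  have := D.flat
  obtain ⟨k, a, y, hx, ha⟩ := Module.Flat.isTrivialRelation_of_sum_smul_eq_zero
    (R := ℂ[ε]) (M := D.O) (ι := Unit) (f := fun _ => ε) (x := fun _ => x)
    (by simpa [Algebra.smul_def] using h)
  rw [show x = _ from hx (), map_sum]
  refine Finset.sum_eq_zero fun j _ => ?_
  have h0 : (a () j).fst = 0 := by
    have := congrArg TrivSqZeroExt.snd (ha j)
    simpa using this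
  have h1 : a () j = ε * TrivSqZeroExt.inl (a () j).snd := by
    ext <;> simp [h0]
  rw [h1, Algebra.smul_def, map_mul, map_mul, map_mul, D.π_eps, zero_mul, zero_mul]

/-- Over the local ring at a minimal prime, the projection `D.π` splits up to first order. -/
theorem exists_derivation [IsReduced B] [Algebra.FiniteType ℂ B] (p : Ideal B) [p.IsPrime]
    (hp : p ∈ minimalPrimes B) :
    ∃ d : D.O →+ Localization.AtPrime p,
      (∀ x y, d (x * y) = D.π x • d y + D.π y • d x) ∧
      (∀ a : ℂ, d (algebraMap ℂ D.O a) = 0) ∧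
      ∀ x, d (D.eps * x) = algebraMap B _ (D.π x) := by
  have : Ring.KrullDimLE 0 (Localization.AtPrime p) := .of_isLocalization _ hp _
  let : Field (Localization.AtPrime p) := Ring.KrullDimLE.isField_of_isReduced.toField
  let q : Ideal D.O := p.comap D.π
  let h : Localization.AtPrime q →ₐ[ℂ] Localization.AtPrime p :=
    Localization.localAlgHom q p D.π rfl
  let e := algebraMap D.O (Localization.AtPrime q) D.eps
  have hmap : ∀ x, h (algebraMap _ _ x) = algebraMap B _ (D.π x) := fun x =>
    Localization.localRingHom_to_map q p D.π.toRingHom rfl x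
  have hunit : ∀ t : q.primeCompl, IsUnit (algebraMap D.O (Localization.AtPrime q) t) :=
    IsLocalization.map_units _
  have hker : ∀ x, h x = 0 → ∃ z, x = e * z := fun x hx => by
    obtain ⟨⟨y, s⟩, hys⟩ := IsLocalization.surj q.primeCompl x
    have hy : algebraMap B (Localization.AtPrime p) (D.π y) = 0 := by
      rw [← hmap, ← hys, map_mul, hx, zero_mul]
    obtain ⟨⟨t, ht⟩, hty⟩ := (IsLocalization.map_eq_zero_iff p.primeCompl _ _).1 hy
    obtain ⟨t, rfl⟩ := D.πsurj t
    obtain ⟨o, ho⟩ := (D.πker (t * y)).1 (by rw [map_mul]; exact hty)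
    obtain ⟨u, hu⟩ := (hunit s).exists_right_inv
    obtain ⟨v, hv⟩ := (hunit ⟨t, ht⟩).exists_right_inv
    refine ⟨algebraMap _ _ o * u * v, ?_⟩
    have ho' := congrArg (algebraMap D.O (Localization.AtPrime q)) ho
    rw [map_mul, map_mul] at ho'
    change _ = e * _ at ho'
    simp only at hys hv
    linear_combination (u * v) * ho' - x * hu - (x * algebraMap _ _ s.1 * u) * hv +
      (algebraMap _ _ t * u * v) * hys
  have hann : ∀ z, e * z = 0 → h z = 0 := fun z hz => by
    obtain ⟨⟨y, s⟩, hys⟩ := IsLocalization.surj q.primeCompl z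
    have hy : algebraMap D.O (Localization.AtPrime q) (D.eps * y) = 0 := by
      rw [map_mul, ← hys, ← mul_assoc]
      exact (congrArg (· * _) hz).trans (zero_mul _)
    obtain ⟨t, hty⟩ := (IsLocalization.map_eq_zero_iff q.primeCompl _ _).1 hy
    have hπ : D.π (t * y) = 0 :=
      D.π_eq_zero_of_eps_mul_eq_zero (by rw [← hty]; ring)
    have hz' : h (algebraMap _ _ t.1) * (h z * h (algebraMap _ _ s.1)) = 0 := by
      rw [← map_mul, hys, ← map_mul, ← map_mul, hmap, hπ, map_zero]
    rw [((hunit t).map h).mul_right_eq_zero, ((hunit s).map h).mul_left_eq_zero] at hz'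
    exact hz'
  have he : h e = 0 := by rw [hmap, D.π_eps, map_zero]
  have hsurj : Function.Surjective h := fun x => by
    obtain ⟨⟨y, ⟨t, ht⟩⟩, hyt⟩ := IsLocalization.surj p.primeCompl x
    obtain ⟨y, rfl⟩ := D.πsurj y
    obtain ⟨t, rfl⟩ := D.πsurj t
    obtain ⟨u, hu⟩ := (hunit ⟨t, ht⟩).exists_right_inv
    refine ⟨algebraMap _ _ y * u, ?_⟩
    have hu' := congrArg h hu
    rw [map_mul, hmap, map_one] at hu'
    rw [map_mul, hmap]
    simp only at hyt hu'
    linear_combination x * hu' - h u * hyt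
  have hnil : IsNilpotent (RingHom.ker (h : Localization.AtPrime q →+* Localization.AtPrime p)) := by
    refine ⟨2, ?_⟩
    rw [pow_two, Ideal.zero_eq_bot, eq_bot_iff, Ideal.mul_le]
    intro x hx y hy
    obtain ⟨x, rfl⟩ := hker x hx
    obtain ⟨y, rfl⟩ := hker y hy
    have hee : e * e = 0 := by rw [← map_mul, D.eps_mul_eps, map_zero]
    rw [Ideal.mem_bot]
    linear_combination (x * y) * hee
  obtain ⟨d, hd₁, hd₂, hd₃⟩ := exists_derivation_of_section h
    (Algebra.FormallySmooth.liftOfSurjective (AlgHom.id ℂ _) h hsurj hnil)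
    (Algebra.FormallySmooth.liftOfSurjective_apply (AlgHom.id ℂ _) h hsurj hnil) e hker hann he
  refine ⟨d.comp (algebraMap D.O (Localization.AtPrime q)).toAddMonoidHom,
    fun x y => ?_, fun a => ?_, fun x => ?_⟩
  · change d (algebraMap D.O _ (x * y)) =
      _ • d (algebraMap D.O _ y) + _ • d (algebraMap D.O _ x)
    rw [map_mul, hd₁, hmap, hmap, Algebra.smul_def, Algebra.smul_def]
  · change d (algebraMap D.O _ (algebraMap ℂ D.O a)) = 0
    rw [← IsScalarTower.algebraMap_apply, hd₂]
  · change d (algebraMap D.O _ (D.eps * x)) = _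
    rw [map_mul, hd₃, hmap]

theorem exists_operator_of_derivation {T : Type*} [AddCommGroup T] [Module B T] (g : M →ₗ[B] B)
    (d : D.O →+ T) (hd : ∀ x y, d (x * y) = D.π x • d y + D.π y • d x) :
    ∃ δ : D.Mt →+ T, ∀ r m, δ (r • m) = D.π r • δ m + g (D.σ m) • d r := by
  have : Module.Finite D.O D.Mt := D.inv.1
  have : Module.Projective D.O D.Mt := D.inv.2.1
  obtain ⟨n, c, v, hcv⟩ := exists_dual_basis D.O D.Mt
  refine ⟨AddMonoidHom.mk' (fun m => ∑ i, g (D.σ (v i)) • d (c i m)) fun x y => ?_,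
    fun r m => ?_⟩
  · simp only [map_add, smul_add, Finset.sum_add_distrib]
  · have hg : g (D.σ m) = ∑ i, D.π (c i m) * g (D.σ (v i)) := by
      conv_lhs => rw [← hcv m]
      simp only [map_sum, D.σsmul, map_smul, smul_eq_mul]
    simp only [AddMonoidHom.mk'_apply]
    rw [hg, Finset.smul_sum, Finset.sum_smul, ← Finset.sum_add_distrib]
    refine Finset.sum_congr rfl fun i _ => ?_
    rw [map_smul, smul_eq_mul, hd, smul_add, smul_comm, smul_smul, smul_smul,
      mul_comm (D.π (c i m))]

theorem σ_eq_zero_of_jet_eps_smul_eq_zero [IsReduced B] [Algebra.FiniteType ℂ B]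
    [Module.Finite B M] [Module.Projective B M] (m : D.Mt) (hm : D.jet (D.eps • m) = 0) :
    D.σ m = 0 := by
  obtain ⟨n, c, v, hcv⟩ := exists_dual_basis B M
  rw [← hcv (D.σ m)]
  refine Finset.sum_eq_zero fun i _ => ?_
  suffices h : c i (D.σ m) = 0 by rw [h, zero_smul]
  rw [← Ideal.mem_bot, ← Ideal.zero_eq_bot, ← nilradical_eq_zero B, nilradical,
    ← Ideal.sInf_minimalPrimes, Ideal.mem_sInf]
  intro p hp
  have : p.IsPrime := hp.1.1
  obtain ⟨d, hd₁, hd₂, hd₃⟩ := D.exists_derivation p hp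
  obtain ⟨δ, hδ⟩ := D.exists_operator_of_derivation (c i) d hd₁
  obtain ⟨f, hf⟩ := FirstOrderDeformation.exists_lift (δ := δ) (fun r s x => by
    change _ + (D.π r * D.π s) • _ = D.π r • _ + D.π s • _
    rw [hδ, hδ, hδ, hd₁, map_mul]
    module) (fun a x => by rw [hδ, hd₂, smul_zero, add_zero, D.π.commutes])
  have hd : d D.eps = 1 := by
    rw [← mul_one D.eps, hd₃, map_one, map_one]
  have h0 : algebraMap B (Localization.AtPrime p) (c i (D.σ m)) = 0 := by
    have := hf (D.eps • m)
    rwa [hm, map_zero, hδ, D.π_eps, zero_smul, zero_add, hd, Algebra.smul_def, mul_one,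
      eq_comm] at this
  obtain ⟨t, ht⟩ := (IsLocalization.map_eq_zero_iff p.primeCompl _ _).1 h0
  exact (Ideal.IsPrime.mem_or_mem ‹_› (ht ▸ p.zero_mem)).resolve_left t.2

end FirstOrderDeformation

end Reduced

/-- for `B` a reduced commutative `ℂ`-algebra of finite type and `M` an
invertible `B`-module, there is a natural bijection between the set of isomorphism
classes of first-order deformations of the pair `(B, M)` and the group
`Ext¹_B(P¹_{B/ℂ}(M), M)` (realized as the set of equivalence classes of `B`-module
extensions of `P¹_{B/ℂ}(M)` by `M`), sending `(Õ, M̃)` to the class of the extension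
`0 → M → P¹_{Õ/ℂ}(M̃) ⊗_Õ B → P¹_{B/ℂ}(M) → 0`. -/
theorem stmt13 (B M : Type u) [CommRing B] [Algebra ℂ B] [IsReduced B]
    [Algebra.FiniteType ℂ B] [AddCommGroup M] [Module B M]
    (hM : IsInvertibleModule B M) :
    ∃ Φ : Quot (FirstOrderDeformation.Iso (B := B) (M := M)) →
        Quot (ModuleExtension.Iso (B := B) (F := JetModule ℂ B M) (G := M)),
      Function.Bijective Φ ∧
      ∀ (D : FirstOrderDeformation B M) (ext : ModuleExtension B (JetModule ℂ B M) M),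
        IsJetExtension D ext → Φ (Quot.mk _ D) = Quot.mk _ ext := by
  have := hM.module_invertible
  choose X δ hδ hX using fun D : FirstOrderDeformation B M =>
    exists_universal_isLink D D.σ_eq_zero_of_jet_eps_smul_eq_zero
  refine ⟨Quot.lift (fun D => Quot.mk _ (X D)) fun D D' hD => ?_, ⟨?_, ?_⟩, fun D ext hext => ?_⟩
  · obtain ⟨δ', hδ'⟩ := (hδ D').iso_comp hD
    exact Quot.sound (hX D _ δ' hδ')
  · rintro ⟨D⟩ ⟨D'⟩ hDD'
    have hiso : (X D).Iso (X D') :=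
      ModuleExtension.Iso.equivalence.eqvGen_iff.1 (Quot.eqvGen_exact hDD')
    obtain ⟨δ', hδ'⟩ := (hδ D).comp_iso hiso
    exact Quot.sound (hδ'.iso_toDeformation.trans (hδ D').iso_toDeformation.symm)
  · rintro ⟨Y⟩
    obtain ⟨δ', hδ'⟩ := Y.exists_isLink_toDeformation
    exact ⟨Quot.mk _ Y.toDeformation, Quot.sound (hX _ Y δ' hδ')⟩
  · obtain ⟨δ', hδ'⟩ := hext.exists_isLink
    exact Quot.sound (hX D ext δ' hδ')
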